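/- Let f ∈ ℤ[X] be a polynomial of degree 2. Then there exist an integer k ≥ 2 and an integer n ≥ 0 such that none of the values f(n+1), f(n+2), …, f(n+k) is coprime to all the others; that is, for every i ∈ {1,…,k} there exists j ∈ {1,…,k} with j ≠ i and gcd(f(n+i), f(n+j)) > 1. -/

import Mathlib

theorem exists_coprime_jacobiSym_eq_neg_one {D : ℤ} (hD : ¬ IsSquare D) :
    ∃ b : ℕ, b.Coprime (4 * D.natAbs) ∧ jacobiSym D b = -1 := by
  have hD0 : D ≠ 0 := fun h ↦ hD (h ▸ IsSquare.zero)
  obtain ⟨r, s, hrs, hr⟩ := Nat.sq_mul_squarefree D.natAbs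
  have hN0 : D.natAbs ≠ 0 := Int.natAbs_ne_zero.mpr hD0
  have hs0 : s ≠ 0 := by rintro rfl; simp at hrs; exact hN0 hrs.symm
  obtain ⟨u, hu, hDu⟩ : ∃ u : ℤ, (u = 1 ∨ u = -1) ∧ D = u * ((s : ℤ) ^ 2 * r) := by
    have : ((s : ℤ) ^ 2 * r) = (D.natAbs : ℤ) := by rw [← hrs]; push_cast; rfl
    rw [this]
    rcases Int.natAbs_eq D with h | h
    · exact ⟨1, .inl rfl, by rw [one_mul]; exact h⟩
    · exact ⟨-1, .inr rfl, by rw [neg_one_mul]; exact h⟩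
  have hjac (b : ℕ) (hb : b.Coprime (4 * D.natAbs)) :
      jacobiSym D b = jacobiSym u b * jacobiSym r b := by
    have hbs : Int.gcd (s : ℤ) b = 1 := by
      rw [Int.gcd_natCast_natCast]
      refine (hb.coprime_dvd_right ?_).symm
      rw [← hrs]
      exact Dvd.intro (4 * s * r) (by ring)
    rw [hDu, jacobiSym.mul_left, jacobiSym.mul_left, jacobiSym.sq_one' hbs, one_mul]
  have hju (b : ℕ) (hb : b % 4 = 1) : jacobiSym u b = 1 := by
    rcases hu with rfl | rfl
    · exact jacobiSym.one_left b
    · rw [jacobiSym.at_neg_one (Nat.odd_iff.mpr (by omega)), ZMod.χ₄_nat_one_mod_four hb]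
  by_cases hodd : ∃ p, p.Prime ∧ p ≠ 2 ∧ p ∣ r
  · obtain ⟨p, hp, hp2, m, rfl⟩ := hodd
    have : Fact p.Prime := ⟨hp⟩
    have hpm : ¬ p ∣ m := fun h ↦ hp.not_isUnit (hr p (mul_dvd_mul_left p h))
    obtain ⟨e, n, hpn, hn⟩ := Nat.exists_eq_pow_mul_and_not_dvd hN0 p hp.ne_one
    obtain ⟨v, hv⟩ := FiniteField.exists_nonsquare (F := ZMod p) (by rwa [ZMod.ringChar_zmod_n])
    have hp4 : p.Coprime 4 := by
      have := (Nat.coprime_primes hp Nat.prime_two).mpr hp2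
      exact this.pow_right 2
    have hpn' : p.Coprime (4 * n) := hp4.mul_right ((Nat.Prime.coprime_iff_not_dvd hp).mpr hpn)
    obtain ⟨b, hbn, hbp⟩ := Nat.chineseRemainder hpn'.symm 1 v.val
    have hb4 : b % 4 = 1 := (hbn.of_mul_right n : b ≡ 1 [MOD 4])
    have hbodd : Odd b := Nat.odd_iff.mpr (by omega)
    have hbv : ((b : ℤ) : ZMod p) = v := by
      have := (ZMod.natCast_eq_natCast_iff _ _ _).mpr hbp
      simpa using this
    have hJbp : jacobiSym b p = -1 := by
      rw [← jacobiSym.legendreSym.to_jacobiSym, legendreSym.eq_neg_one_iff, hbv]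
      exact hv
    have hbcop : b.Coprime (4 * D.natAbs) := by
      have h1 : b.Coprime (4 * n) := by
        rw [Nat.Coprime, hbn.gcd_eq]; simp
      have h2 : b.Coprime p := by
        refine ((Nat.Prime.coprime_iff_not_dvd hp).mpr fun h ↦ hv ?_).symm
        have : ((b : ℤ) : ZMod p) = 0 := by
          simpa using (ZMod.natCast_eq_zero_iff b p).mpr h
        rw [← hbv, this]
        exact IsSquare.zero
      rw [hn, show 4 * (p ^ e * n) = p ^ e * (4 * n) by ring]
      exact (h2.pow_right e).mul_right h1
    refine ⟨b, hbcop, ?_⟩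
    have hm0 : m ≠ 0 := by rintro rfl; simp at hpm
    have hmn : m ∣ n := by
      have h1 : m ∣ p ^ e * n := by rw [← hn, ← hrs]; exact Dvd.intro (s ^ 2 * p) (by ring)
      exact (((Nat.Prime.coprime_iff_not_dvd hp).mpr hpm).symm.pow_right e).dvd_of_dvd_mul_left h1
    have hJm : jacobiSym m b = 1 := by
      rw [jacobiSym.mod_right _ hbodd, Int.natAbs_natCast]
      have h1 : b ≡ 1 [MOD 4 * m] := hbn.of_dvd (mul_dvd_mul_left 4 hmn)
      rw [h1, Nat.mod_eq_of_lt (by omega), jacobiSym.one_right]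
    rw [hjac b hbcop, hju b hb4, one_mul, Nat.cast_mul, jacobiSym.mul_left, hJm, mul_one,
      ← jacobiSym.quadratic_reciprocity_one_mod_four hb4 (hp.odd_of_ne_two hp2), hJbp]
  · push Not at hodd
    have hr2 : r ∣ 2 := by
      rw [← Nat.prod_primeFactors_of_squarefree hr]
      have hsub : r.primeFactors ⊆ {2} := fun p hp ↦ by
        rw [Finset.mem_singleton]
        by_contra h
        exact hodd p (Nat.prime_of_mem_primeFactors hp) h (Nat.dvd_of_mem_primeFactors hp)
      simpa using Finset.prod_dvd_prod_of_subset _ _ (fun p ↦ p) hsub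
    rcases (Nat.dvd_prime Nat.prime_two).mp hr2 with rfl | rfl
    · have hu' : u = -1 := hu.resolve_left fun h ↦ hD ⟨s, by rw [hDu, h]; push_cast; ring⟩
      have hb3 : (4 * s ^ 2 - 1) % 4 = 3 := by
        have := Nat.pos_of_ne_zero (pow_ne_zero 2 hs0)
        omega
      have hcop : (4 * s ^ 2 - 1).Coprime (4 * D.natAbs) := by
        rw [← hrs, mul_one]
        have := Nat.pos_of_ne_zero (pow_ne_zero 2 hs0)
        exact (Nat.coprime_self_sub_left (by omega)).mpr (by simp)
      refine ⟨4 * s ^ 2 - 1, hcop, ?_⟩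
      rw [hjac _ hcop, hu', jacobiSym.at_neg_one (Nat.odd_iff.mpr (by omega)),
        ZMod.χ₄_nat_three_mod_four hb3]
      simp
    · obtain ⟨e, t, ht, hst⟩ := Nat.exists_eq_pow_mul_and_not_dvd hs0 2 (by norm_num)
      have hb5 : (4 * t ^ 2 + 1) % 8 = 5 := by
        have : t % 8 = 1 ∨ t % 8 = 3 ∨ t % 8 = 5 ∨ t % 8 = 7 := by omega
        rcases this with h | h | h | h <;> simp [Nat.add_mod, Nat.mul_mod, Nat.pow_mod, h]
      have hcop : (4 * t ^ 2 + 1).Coprime (4 * D.natAbs) := by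
        have h1 : (4 * t ^ 2 + 1).Coprime 2 := by
          rw [Nat.coprime_two_right, Nat.odd_iff]; omega
        have h2 : (4 * t ^ 2 + 1).Coprime (t ^ 2) :=
          Nat.isCoprime_iff_coprime.mp ⟨1, -4, by push_cast; ring⟩
        rw [← hrs, hst, show 4 * ((2 ^ e * t) ^ 2 * 2) = 2 ^ (2 * e + 3) * t ^ 2 by ring]
        exact (h1.pow_right _).mul_right h2
      refine ⟨4 * t ^ 2 + 1, hcop, ?_⟩
      rw [hjac _ hcop, hju _ (by omega), one_mul, Nat.cast_ofNat,
        jacobiSym.at_two (Nat.odd_iff.mpr (by omega)), ZMod.χ₈_nat_eq_if_mod_eight, hb5]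
      norm_num
      omega

section

open Finset Real ArithmeticFunction.vonMangoldt
open ArithmeticFunction (vonMangoldt)

theorem exists_abs_tsum_residueClass_sub_le {q : ℕ} [NeZero q] {a : ZMod q} (ha : IsUnit a) :
    ∃ C : ℝ, 0 ≤ C ∧ ∀ x ∈ Set.Ioc (1 : ℝ) 2,
      |∑' n, residueClass a n / (n : ℝ) ^ x - (q.totient : ℝ)⁻¹ / (x - 1)| ≤ C := by
  have H {x : ℝ} (hx : 1 < x) :
      ∑' n, residueClass a n / (n : ℝ) ^ x =
        (LFunctionResidueClassAux a x).re + (q.totient : ℝ)⁻¹ / (x - 1) := by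
    refine Complex.ofReal_injective ?_
    simp only [Complex.ofReal_tsum, Complex.ofReal_div, Complex.ofReal_cpow (Nat.cast_nonneg _),
      Complex.ofReal_natCast, Complex.ofReal_add, Complex.ofReal_inv, Complex.ofReal_sub,
      Complex.ofReal_one]
    simp_rw [← LFunctionResidueClassAux_real ha hx,
      eqOn_LFunctionResidueClassAux ha <| Set.mem_ofPred.mpr (Complex.ofReal_re x ▸ hx),
      sub_add_cancel, LSeries, LSeries.term]
    refine tsum_congr fun n ↦ ?_
    split_ifs with hn
    · simp only [hn, residueClass_apply_zero, Complex.ofReal_zero, zero_div]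
    · rfl
  have hcont : ContinuousOn (fun x : ℝ ↦ (LFunctionResidueClassAux a x).re) (Set.Icc 1 2) :=
    Complex.continuous_re.continuousOn.comp (t := Set.univ)
      (continuousOn_LFunctionResidueClassAux a) (fun _ _ ↦ trivial) |>.comp
        Complex.continuous_ofReal.continuousOn fun x hx ↦ by
          simpa only [Set.mem_ofPred_eq, Complex.ofReal_re] using hx.1
  obtain ⟨C, hC⟩ := isCompact_Icc.exists_bound_of_continuousOn hcont
  refine ⟨max C 0, le_max_right _ _, fun x hx ↦ ?_⟩
  rw [H hx.1, add_sub_cancel_right]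
  exact (hC x (Set.mem_Icc_of_Ioc hx)).trans (le_max_left _ _)

theorem summable_residueClass_div_rpow {q : ℕ} (a : ZMod q) {x : ℝ} (hx : 1 < x) :
    Summable fun n : ℕ ↦ residueClass a n / (n : ℝ) ^ x :=
  LSeries.summable_real_of_abscissaOfAbsConv_lt <|
    (abscissaOfAbsConv_residueClass_le_one a).trans_lt <| mod_cast hx

/-- A Mertens-type lower bound for primes in a residue class. -/
theorem exists_log_le_sum_residueClass_div {q : ℕ} [NeZero q] {a : ZMod q} (ha : IsUnit a) :
    ∃ c > 0, ∃ C : ℝ, ∀ N : ℕ, 1 ≤ N →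
      c * log N - C ≤ ∑ n ∈ Icc 1 N, residueClass a n / n := by
  obtain ⟨C, hC0, hC⟩ := exists_abs_tsum_residueClass_sub_le ha
  have hφ : 0 < (q.totient : ℝ)⁻¹ := inv_pos.mpr (mod_cast q.totient.pos_of_neZero)
  set φ := (q.totient : ℝ)⁻¹ with hφdef
  have key (N : ℕ) (hN : 4 ≤ log N) :
      φ / 8 * log N - 2 * C ≤ ∑ n ∈ Icc 1 N, residueClass a n / n := by
    have hN1 : (1 : ℝ) < N := by
      by_contra! h
      have := log_nonpos (Nat.cast_nonneg N) h
      linarith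
    set σ : ℝ := 4 / log N with hσ
    have hσ0 : 0 < σ := by positivity
    have hσ1 : σ ≤ 1 := by rw [hσ, div_le_one (by linarith)]; exact hN
    have hNσ : (N : ℝ) ^ (-(σ / 2)) ≤ 1 / 4 := by
      rw [rpow_def_of_pos (by linarith), show log N * -(σ / 2) = -2 by
        rw [hσ]; field_simp; norm_num, exp_neg, one_div]
      apply inv_anti₀ (by norm_num)
      have := add_one_le_exp (1 : ℝ)
      rw [show (2 : ℝ) = 1 + 1 by norm_num, exp_add]
      nlinarith
    have h1 := abs_le.mp (hC (1 + σ) ⟨by linarith, by linarith⟩)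
    have h2 := abs_le.mp (hC (1 + σ / 2) ⟨by linarith, by linarith⟩)
    have s1 := summable_residueClass_div_rpow a (x := 1 + σ) (by linarith)
    have s2 := summable_residueClass_div_rpow a (x := 1 + σ / 2) (by linarith)
    have hle : ∑' n, residueClass a n / (n : ℝ) ^ (1 + σ) ≤
        ∑ n ∈ Icc 1 N, residueClass a n / n +
          1 / 4 * ∑' n, residueClass a n / (n : ℝ) ^ (1 + σ / 2) := by
      rw [← tsum_mul_left, ← s1.sum_add_tsum_compl (s := Icc 1 N)]
      refine add_le_add (Finset.sum_le_sum fun n hn ↦ ?_) ?_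
      · have hn1 : (1 : ℝ) ≤ n := by exact_mod_cast (Finset.mem_Icc.mp hn).1
        refine div_le_div_of_nonneg_left (residueClass_nonneg a _) (by linarith) ?_
        conv_lhs => rw [← Real.rpow_one n]
        exact rpow_le_rpow_of_exponent_le hn1 (by linarith)
      · refine le_trans ?_ ((s2.mul_left (1 / 4)).tsum_subtype_le _ (↑(Icc 1 N) : Set ℕ)ᶜ
          fun n ↦ mul_nonneg (by norm_num) (div_nonneg (residueClass_nonneg a _) (by positivity)))
        refine Summable.tsum_le_tsum (fun n ↦ ?_) (s1.subtype _) ((s2.mul_left (1 / 4)).subtype _)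
        obtain ⟨n, hn⟩ := n
        rcases n.eq_zero_or_pos with rfl | hn0
        · simp
        have hn' : (N : ℝ) ≤ n := by
          simp only [Set.mem_compl_iff, mem_coe, Finset.mem_Icc, not_and, not_le] at hn
          exact_mod_cast (hn hn0).le
        have hnpos : (0 : ℝ) < n := by linarith
        have e : (n : ℝ) ^ (1 + σ / 2) = (n : ℝ) ^ (1 + σ) * (n : ℝ) ^ (-(σ / 2)) := by
          rw [← rpow_add hnpos]; ring_nf
        have e2 : (n : ℝ) ^ (-(σ / 2)) ≤ 1 / 4 :=
          (rpow_le_rpow_of_nonpos (by linarith) hn' (by linarith)).trans hNσ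
        have e3 : 0 < (n : ℝ) ^ (-(σ / 2)) := rpow_pos_of_pos hnpos _
        have e4 : 0 < (n : ℝ) ^ (1 + σ) := rpow_pos_of_pos hnpos _
        simp only
        rw [e, ← mul_div_assoc, div_le_div_iff₀ e4 (by positivity)]
        have := mul_nonneg (residueClass_nonneg a n) e4.le
        nlinarith
    have e1 : φ / (1 + σ - 1) = φ / 4 * log N := by
      rw [hσ]; field_simp; ring
    have e2 : φ / (1 + σ / 2 - 1) = φ / 2 * log N := by
      rw [hσ]; field_simp; ring
    rw [e1] at h1
    rw [e2] at h2
    linarith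
  refine ⟨φ / 8, by positivity, 2 * C + φ / 2, fun N hN ↦ ?_⟩
  by_cases h : 4 ≤ log N
  · linarith [key N h]
  · refine le_trans ?_ (Finset.sum_nonneg fun n _ ↦
      div_nonneg (residueClass_nonneg a n) (Nat.cast_nonneg n))
    nlinarith

/-- The reciprocals of the primes in an invertible residue class have divergent sum. -/
theorem not_summable_one_div_prime_eq_mod {q : ℕ} [NeZero q] {a : ZMod q} (ha : IsUnit a) :
    ¬ Summable fun n : ℕ ↦ if n.Prime ∧ (n : ZMod q) = a then (1 : ℝ) / n else 0 := by
  intro hs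
  obtain ⟨c, hc, C, hC⟩ := exists_log_le_sum_residueClass_div ha
  set g := fun n : ℕ ↦ if n.Prime ∧ (n : ZMod q) = a then (1 : ℝ) / n else 0 with hg
  have hg0 (n : ℕ) : 0 ≤ g n := by simp only [hg]; split_ifs <;> positivity
  have hnp := summable_residueClass_non_primes_div a
  set h := fun n : ℕ ↦ (if n.Prime then 0 else residueClass a n) / (n : ℝ) with hh
  have hh0 (n : ℕ) : 0 ≤ h n := by
    simp only [hh]
    split_ifs
    · simp
    · exact div_nonneg (residueClass_nonneg a n) (Nat.cast_nonneg n)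
  obtain ⟨s, hs'⟩ := summable_iff_vanishing_norm.mp hs (c / 2) (by positivity)
  set B := ∑ n ∈ s, log n * g n
  have bound (N : ℕ) (hN : 1 ≤ N) : c / 2 * log N ≤ C + ∑' n, h n + B := by
    have h1 := hC N hN
    have hlogN : 0 ≤ log N := log_natCast_nonneg N
    have h2 : ∑ n ∈ Icc 1 N, residueClass a n / n ≤
        ∑ n ∈ Icc 1 N, h n + ∑ n ∈ Icc 1 N, log n * g n := by
      rw [← Finset.sum_add_distrib]
      refine Finset.sum_le_sum fun n _ ↦ ?_
      simp only [hh, hg]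
      by_cases hp : n.Prime
      · by_cases hna : (n : ZMod q) = a
        · simp [hp, hna, residueClass, ArithmeticFunction.vonMangoldt_apply_prime hp, div_eq_mul_inv]
        · simp [hp, hna, residueClass]
      · simp [hp]
    have h3 : ∑ n ∈ Icc 1 N, h n ≤ ∑' n, h n := hnp.sum_le_tsum _ fun n _ ↦ hh0 n
    have h4 : ∑ n ∈ Icc 1 N, log n * g n ≤ B + log N * (c / 2) := by
      have h5 : ∑ n ∈ Icc 1 N \ s, log n * g n ≤ log N * (c / 2) := by
        have := (le_norm_self _).trans (hs' (Icc 1 N \ s) sdiff_disjoint).le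
        refine le_trans ?_ (mul_le_mul_of_nonneg_left this hlogN)
        rw [Finset.mul_sum]
        refine Finset.sum_le_sum fun n hn ↦ mul_le_mul_of_nonneg_right ?_ (hg0 n)
        simp only [mem_sdiff, Finset.mem_Icc] at hn
        exact log_le_log (by exact_mod_cast hn.1.1) (by exact_mod_cast hn.1.2)
      have h6 : ∑ n ∈ Icc 1 N ∩ s, log n * g n ≤ B :=
        Finset.sum_le_sum_of_subset_of_nonneg inter_subset_right
          fun n _ _ ↦ mul_nonneg (log_natCast_nonneg n) (hg0 n)
      rw [← Finset.sum_inter_add_sum_sdiff (Icc 1 N) s]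
      linarith
    linarith
  have := (tendsto_log_atTop.comp tendsto_natCast_atTop_atTop).eventually_gt_atTop
    ((C + ∑' n, h n + B) / (c / 2))
  obtain ⟨N, hN, hN1⟩ := (this.and (Filter.eventually_ge_atTop 1)).exists
  have := bound N hN1
  rw [Function.comp_apply, div_lt_iff₀ (by positivity)] at hN
  linarith

theorem exists_primes_eq_mod_prod_le {q : ℕ} [NeZero q] {a : ZMod q} (ha : IsUnit a)
    {ε : ℝ} (hε : 0 < ε) :
    ∃ P : Finset ℕ, (∀ p ∈ P, p.Prime ∧ (p : ZMod q) = a) ∧ ∏ p ∈ P, (1 - 1 / (p : ℝ)) ≤ ε := by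
  have h := (not_summable_iff_tendsto_nat_atTop_of_nonneg fun n ↦ by
    split_ifs <;> positivity).mp (not_summable_one_div_prime_eq_mod ha)
  obtain ⟨N, hN⟩ := (h.eventually_ge_atTop (-log ε)).exists
  refine ⟨(range N).filter fun p : ℕ ↦ p.Prime ∧ (p : ZMod q) = a,
    fun p hp ↦ (mem_filter.mp hp).2, ?_⟩
  rw [← Finset.sum_filter] at hN
  calc ∏ p ∈ (range N).filter fun p : ℕ ↦ p.Prime ∧ (p : ZMod q) = a, (1 - 1 / (p : ℝ))
      ≤ ∏ p ∈ (range N).filter fun p : ℕ ↦ p.Prime ∧ (p : ZMod q) = a, exp (-(1 / (p : ℝ))) := by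
        refine Finset.prod_le_prod (fun p hp ↦ ?_) fun p _ ↦ one_sub_le_exp_neg _
        have : (1 : ℝ) ≤ p := by exact_mod_cast (mem_filter.mp hp).2.1.one_le
        rw [sub_nonneg, div_le_one (by linarith)]
        exact this
    _ = exp (-∑ p ∈ (range N).filter fun p : ℕ ↦ p.Prime ∧ (p : ZMod q) = a, 1 / (p : ℝ)) := by
        rw [← exp_sum, Finset.sum_neg_distrib]
    _ ≤ ε := by
        rw [← le_log_iff_exp_le hε]
        linarith

theorem card_Icc_filter_modEq_le (T m : ℕ) (hm : 0 < m) (v : ℤ) :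
    #((Icc 1 T).filter fun t : ℕ ↦ (m : ℤ) ∣ (t : ℤ) - v) ≤ T / m + 1 := by
  have h := Int.Ioc_filter_modEq_card 0 (T : ℤ) (r := (m : ℤ)) (by exact_mod_cast hm) v
  have h1 : #((Icc 1 T).filter fun t : ℕ ↦ (m : ℤ) ∣ (t : ℤ) - v) ≤
      #{x ∈ Ioc 0 (T : ℤ) | x ≡ v [ZMOD m]} := by
    refine Finset.card_le_card_of_injOn (fun t ↦ (t : ℤ)) (fun t ht ↦ ?_)
      Nat.cast_injective.injOn
    simp only [coe_filter, mem_Icc, Set.mem_ofPred_eq, mem_Ioc] at ht ⊢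
    exact ⟨⟨by omega, by omega⟩, (Int.modEq_iff_dvd.mpr ht.2).symm⟩
  have hmZ : (0 : ℤ) < m := by exact_mod_cast hm
  zify
  refine (Nat.cast_le.mpr h1).trans ?_
  have e1 : ⌊((T : ℤ) - v : ℚ) / (m : ℤ)⌋ = (T - v) / (m : ℤ) := by
    simpa using Rat.floor_intCast_div_natCast (T - v) m
  have e2 : ⌊((0 : ℤ) - v : ℚ) / (m : ℤ)⌋ = (-v) / (m : ℤ) := by
    simpa using Rat.floor_intCast_div_natCast (-v) m
  rw [h, e1, e2]
  have f1 := Int.ediv_mul_le ((T : ℤ) - v) hmZ.ne'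
  have f2 := Int.lt_ediv_add_one_mul_self (-v) hmZ
  have f3 := Int.lt_ediv_add_one_mul_self (T : ℤ) hmZ
  have f4 : (m : ℤ) * ((T - v) / (m : ℤ) - (-v) / (m : ℤ)) < m * (T / m + 2) := by nlinarith
  have f5 := lt_of_mul_lt_mul_left f4 hmZ.le
  have f6 : (0 : ℤ) ≤ T / m := by positivity
  omega

theorem card_filter_dvd_mul_sq_sub_one_le {g : ℤ} (hg : 2 ∣ g) (T : ℕ) {p k : ℕ} (hp : p.Prime)
    (hk : k ≠ 0) :
    #((Icc 1 T).filter fun t : ℕ ↦ p ^ k ∣ (g * (t : ℤ) ^ 2 - 1).natAbs) ≤ 2 * (T / p ^ k + 1) := by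
  obtain h | ⟨s, hs⟩ :=
    ((Icc 1 T).filter fun t : ℕ ↦ p ^ k ∣ (g * (t : ℤ) ^ 2 - 1).natAbs).eq_empty_or_nonempty
  · simp [h]
  have hpZ : Prime (p : ℤ) := Nat.prime_iff_prime_int.mp hp
  have hdvd (t : ℕ) : p ^ k ∣ (g * (t : ℤ) ^ 2 - 1).natAbs ↔ (p : ℤ) ^ k ∣ g * (t : ℤ) ^ 2 - 1 := by
    rw [← Int.natCast_dvd]; push_cast; rfl
  simp only [hdvd] at hs ⊢
  have hs := (mem_filter.mp hs).2
  have hps : (p : ℤ) ∣ g * (s : ℤ) ^ 2 - 1 := (dvd_pow_self _ hk).trans hs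
  have hpg : ¬ (p : ℤ) ∣ g := fun h ↦ hpZ.not_dvd_one <| by
    have := dvd_sub (h.mul_right ((s : ℤ) ^ 2)) hps
    rwa [sub_sub_cancel] at this
  have hp2s : ¬ (p : ℤ) ∣ 2 * s := fun h ↦ by
    rcases hpZ.dvd_or_dvd h with h | h
    · exact hpg (h.trans hg)
    · exact hpZ.not_dvd_one <| by
        simpa only [sub_sub_cancel] using dvd_sub ((h.mul_left (g * s)).trans (dvd_of_eq (by ring) :
          g * s * s ∣ g * (s : ℤ) ^ 2)) hps
  have hpos : 0 < p ^ k := pow_pos hp.pos k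
  have hsub : ((Icc 1 T).filter fun t : ℕ ↦ (p : ℤ) ^ k ∣ g * (t : ℤ) ^ 2 - 1) ⊆
      ((Icc 1 T).filter fun t : ℕ ↦ ((p ^ k : ℕ) : ℤ) ∣ (t : ℤ) - s) ∪
        ((Icc 1 T).filter fun t : ℕ ↦ ((p ^ k : ℕ) : ℤ) ∣ (t : ℤ) - (-s : ℤ)) := by
    intro t ht
    obtain ⟨htT, ht⟩ := mem_filter.mp ht
    have h1 : (p : ℤ) ^ k ∣ g * ((t - s) * (t + s)) :=
      (dvd_sub ht hs).trans (dvd_of_eq (by ring))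
    have h2 := hpZ.pow_dvd_of_dvd_mul_left k hpg h1
    simp only [mem_union, mem_filter, htT, true_and]
    push_cast
    by_cases h3 : (p : ℤ) ∣ t - s
    · left
      refine hpZ.pow_dvd_of_dvd_mul_right k (fun h4 ↦ hp2s ?_) h2
      simpa [two_mul] using dvd_sub h4 h3
    · right
      simpa using hpZ.pow_dvd_of_dvd_mul_left k h3 h2
  refine (card_le_card hsub).trans ((card_union_le _ _).trans ?_)
  have e1 := card_Icc_filter_modEq_le T _ hpos s
  have e2 := card_Icc_filter_modEq_le T _ hpos (-s)
  omega

theorem sum_log_eq_sum_vonMangoldt_mul_card {s : Finset ℕ} {F : ℕ → ℕ} {B : ℕ}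
    (hF : ∀ t ∈ s, F t ≠ 0) (hB : ∀ t ∈ s, F t ≤ B) :
    ∑ t ∈ s, log (F t) = ∑ m ∈ Icc 1 B, vonMangoldt m * #(s.filter fun t ↦ m ∣ F t) := by
  simp_rw [← ArithmeticFunction.vonMangoldt_sum, mul_comm (vonMangoldt _), ← nsmul_eq_mul,
    ← Finset.sum_const]
  refine Finset.sum_comm' fun t m ↦ ?_
  simp only [Nat.mem_divisors, mem_filter, Finset.mem_Icc]
  refine ⟨fun ⟨ht, hm, h0⟩ ↦ ⟨⟨ht, hm⟩, Nat.pos_of_dvd_of_pos hm (Nat.pos_of_ne_zero h0),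
    (Nat.le_of_dvd (Nat.pos_of_ne_zero h0) hm).trans (hB t ht)⟩, fun ⟨⟨ht, hm⟩, _⟩ ↦
    ⟨ht, hm, hF t ht⟩⟩

theorem sum_vonMangoldt_filter_minFac_mem_le (R : Finset ℕ) (hR : ∀ p ∈ R, p.Prime) {B : ℕ}
    (hB : B ≠ 0) :
    ∑ m ∈ (Icc 1 B).filter (fun m ↦ m.minFac ∈ R), vonMangoldt m ≤ #R * log B := by
  rw [← Finset.sum_fiberwise_of_maps_to (t := R) (g := Nat.minFac)
    fun m hm ↦ (mem_filter.mp hm).2, ← nsmul_eq_mul]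
  refine Finset.sum_le_card_nsmul _ _ _ fun p hp ↦ ?_
  have hpp := hR p hp
  set L := p ^ Nat.log p B
  have hL : L ≠ 0 := pow_ne_zero _ hpp.ne_zero
  calc _ ≤ ∑ m ∈ L.divisors, vonMangoldt m := by
        rw [← Finset.sum_filter_ne_zero]
        refine Finset.sum_le_sum_of_subset_of_nonneg (fun m hm ↦ ?_)
          fun _ _ _ ↦ ArithmeticFunction.vonMangoldt_nonneg
        obtain ⟨hm, hm0⟩ := mem_filter.mp hm
        simp only [mem_filter, Finset.mem_Icc] at hm
        obtain ⟨l, k, hl, hk, rfl⟩ :=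
          (isPrimePow_nat_iff _).mp (ArithmeticFunction.vonMangoldt_ne_zero_iff.mp hm0)
        rw [hl.pow_minFac hk.ne'] at hm
        obtain ⟨⟨⟨-, hm1⟩, -⟩, rfl⟩ := hm
        exact Nat.mem_divisors.mpr ⟨pow_dvd_pow _ (Nat.le_log_of_pow_le hl.one_lt hm1), hL⟩
    _ = log L := ArithmeticFunction.vonMangoldt_sum
    _ ≤ log B := log_le_log (by exact_mod_cast Nat.pos_of_ne_zero hL)
        (by exact_mod_cast Nat.pow_log_le_self p hB)

theorem exists_mul_le_card_primeFactors {g : ℤ} (hg : 2 ∣ g) (hg0 : g ≠ 0) {q : ℕ} [NeZero q]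
    {b : ZMod q} (hb : IsUnit b)
    (hgb : ∀ p k : ℕ, p.Prime → k ≠ 0 → ((p ^ k : ℕ) : ZMod q) = b →
      ∀ t : ℤ, ¬ (p : ℤ) ∣ g * t ^ 2 - 1) :
    ∃ c > (0 : ℝ), ∃ T₀ : ℕ, ∀ T ≥ T₀,
      c * T ≤ #((Icc 1 T).biUnion fun t : ℕ ↦ (g * (t : ℤ) ^ 2 - 1).natAbs.primeFactors) := by
  obtain ⟨c, hc, C, hC⟩ := exists_log_le_sum_residueClass_div hb
  set G := g.natAbs with hG
  have hG2 : 2 ≤ G := by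
    have := Int.natAbs_ne_zero.mpr hg0
    obtain ⟨k, rfl⟩ := hg
    omega
  have main (T : ℕ) (hT : 1 ≤ T) : (T : ℝ) / 2 * (c * log T - C) ≤
      #((Icc 1 T).biUnion fun t : ℕ ↦ (g * (t : ℤ) ^ 2 - 1).natAbs.primeFactors) *
        log ((2 * G * T ^ 2 : ℕ) : ℝ) := by
    set R := (Icc 1 T).biUnion fun t : ℕ ↦ (g * (t : ℤ) ^ 2 - 1).natAbs.primeFactors with hR
    have hRp : ∀ p ∈ R, p.Prime := fun p hp ↦ by
      obtain ⟨t, _, ht⟩ := mem_biUnion.mp hp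
      exact Nat.prime_of_mem_primeFactors ht
    set B := 2 * G * T ^ 2 with hB
    set E : ℕ → ℕ := fun t ↦ (g * (t : ℤ) ^ 2 - 1).natAbs with hE
    have habs (t : ℕ) : (g * (t : ℤ) ^ 2).natAbs = G * t ^ 2 := by
      rw [Int.natAbs_mul, Int.natAbs_pow, Int.natAbs_natCast]
    have hEle (t : ℕ) (ht : t ∈ Icc 1 T) : t ≤ E t ∧ E t ≤ B ∧ t ≤ B := by
      obtain ⟨h1, h2⟩ := Finset.mem_Icc.mp ht
      have e1 := habs t
      have e2 : G * t ^ 2 ≤ G * T ^ 2 := Nat.mul_le_mul_left _ (Nat.pow_le_pow_left h2 2)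
      have e3 : 2 * t ^ 2 ≤ G * t ^ 2 := Nat.mul_le_mul_right _ hG2
      have e4 : t ≤ t ^ 2 := Nat.le_self_pow two_ne_zero t
      have e5 : B = 2 * (G * T ^ 2) := by rw [hB]; ring
      simp only [hE]
      omega
    have hBT : T ≤ B := (hEle T (Finset.mem_Icc.mpr ⟨hT, le_rfl⟩)).2.2
    have hB0 : B ≠ 0 := by omega
    have s1 := sum_log_eq_sum_vonMangoldt_mul_card (s := Icc 1 T) (F := E) (B := B)
      (fun t ht ↦ by have := hEle t ht; have := Finset.mem_Icc.mp ht; omega)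
      (fun t ht ↦ (hEle t ht).2.1)
    have s2 := sum_log_eq_sum_vonMangoldt_mul_card (s := Icc 1 T) (F := fun t ↦ t) (B := B)
      (fun t ht ↦ by have := Finset.mem_Icc.mp ht; omega) (fun t ht ↦ (hEle t ht).2.2)
    have hdiv (m : ℕ) : #((Icc 1 T).filter fun t ↦ m ∣ t) = T / m := by
      rw [← Nat.Ioc_filter_dvd_card_eq_div]; rfl
    simp only [hdiv] at s2
    have hlogs : ∑ t ∈ Icc 1 T, 2 * log t ≤ ∑ t ∈ Icc 1 T, log (E t) := by
      refine Finset.sum_le_sum fun t ht ↦ ?_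
      have ht1 := (Finset.mem_Icc.mp ht).1
      have e3 : 2 * t ^ 2 ≤ G * t ^ 2 := Nat.mul_le_mul_right _ hG2
      have e4 : 1 ≤ t ^ 2 := Nat.one_le_pow _ _ ht1
      have e5 : t ^ 2 ≤ E t := by
        have e1 := habs t
        simp only [hE]
        omega
      calc 2 * log t = log ((t ^ 2 : ℕ) : ℝ) := by push_cast; rw [log_pow]; norm_num
        _ ≤ log (E t) := log_le_log (by exact_mod_cast e4) (by exact_mod_cast e5)
    have hterm (m : ℕ) (hm : m ∈ Icc 1 B) :
        vonMangoldt m * #((Icc 1 T).filter fun t ↦ m ∣ E t) ≤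
          2 * (vonMangoldt m * (T / m : ℕ)) - 2 * (residueClass b m * (T / m : ℕ)) +
            2 * if m.minFac ∈ R then vonMangoldt m else 0 := by
      have hΛ := ArithmeticFunction.vonMangoldt_nonneg (n := m)
      have hif : 0 ≤ if m.minFac ∈ R then vonMangoldt m else 0 := by split_ifs <;> simp [hΛ]
      rcases eq_or_ne (vonMangoldt m) 0 with h0 | h0
      · have : residueClass b m = 0 := by
          rw [residueClass, Set.indicator_apply]; split_ifs <;> simp [h0]
        simp [h0, this]
      obtain ⟨p, k, hp, hk, rfl⟩ :=
        (isPrimePow_nat_iff _).mp (ArithmeticFunction.vonMangoldt_ne_zero_iff.mp h0)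
      have hdvd (t : ℕ) (h : p ^ k ∣ E t) : (p : ℤ) ∣ g * (t : ℤ) ^ 2 - 1 :=
        Int.natCast_dvd.mpr ((dvd_pow_self p hk.ne').trans h)
      by_cases hmb : ((p ^ k : ℕ) : ZMod q) = b
      · have hempty : (Icc 1 T).filter (fun t ↦ p ^ k ∣ E t) = ∅ :=
          Finset.filter_eq_empty_iff.mpr fun t _ h ↦ hgb p k hp hk.ne' hmb t (hdvd t h)
        have hres : residueClass b (p ^ k) = vonMangoldt (p ^ k) :=
          Set.indicator_of_mem (by exact hmb) _
        rw [hempty, hres, Finset.card_empty, Nat.cast_zero, mul_zero, sub_self, zero_add]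
        linarith
      · have hres : residueClass b (p ^ k) = 0 := Set.indicator_of_notMem (by exact hmb) _
        rw [hres, hp.pow_minFac hk.ne']
        by_cases hpR : p ∈ R
        · have := card_filter_dvd_mul_sq_sub_one_le hg T hp hk.ne'
          have this' : (#((Icc 1 T).filter fun t ↦ p ^ k ∣ E t) : ℝ) ≤
              2 * ((T / p ^ k : ℕ) + 1) := by exact_mod_cast this
          rw [if_pos hpR]
          nlinarith [mul_le_mul_of_nonneg_left this' hΛ]
        · have hempty : (Icc 1 T).filter (fun t ↦ p ^ k ∣ E t) = ∅ := by
            refine Finset.filter_eq_empty_iff.mpr fun t ht h ↦ hpR ?_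
            refine mem_biUnion.mpr ⟨t, ht, Nat.mem_primeFactors.mpr
              ⟨hp, (dvd_pow_self p hk.ne').trans h, ?_⟩⟩
            have h1 := hEle t ht
            have h2 := Finset.mem_Icc.mp ht
            exact (by omega : E t ≠ 0)
          rw [hempty, if_neg hpR]
          simp only [Finset.card_empty, Nat.cast_zero, mul_zero, zero_mul, sub_zero, add_zero]
          positivity
    have hupper : ∑ m ∈ Icc 1 B, residueClass b m * (T / m : ℕ) ≤ #R * log B := by
      have h1 := Finset.sum_le_sum hterm
      rw [Finset.sum_add_distrib, Finset.sum_sub_distrib, ← Finset.mul_sum, ← Finset.mul_sum,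
        ← Finset.mul_sum, ← Finset.sum_filter, ← s1, ← s2] at h1
      rw [← Finset.mul_sum] at hlogs
      have := sum_vonMangoldt_filter_minFac_mem_le R hRp hB0
      linarith
    have hres0 (m : ℕ) : 0 ≤ residueClass b m :=
      Set.indicator_nonneg (fun _ _ ↦ ArithmeticFunction.vonMangoldt_nonneg) m
    calc (T : ℝ) / 2 * (c * log T - C) ≤ T / 2 * ∑ n ∈ Icc 1 T, residueClass b n / n :=
          mul_le_mul_of_nonneg_left (hC T hT) (by positivity)
      _ = ∑ m ∈ Icc 1 T, residueClass b m * (T / (2 * m)) := by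
          rw [Finset.mul_sum]
          refine Finset.sum_congr rfl fun m _ ↦ ?_
          rw [div_mul_div_comm, mul_comm (T : ℝ), mul_div_assoc]
      _ ≤ ∑ m ∈ Icc 1 T, residueClass b m * (T / m : ℕ) := by
          refine Finset.sum_le_sum fun m hm ↦ mul_le_mul_of_nonneg_left ?_ (hres0 m)
          obtain ⟨hm1, hmT⟩ := Finset.mem_Icc.mp hm
          have h1 : 1 ≤ T / m := (Nat.one_le_div_iff (by omega)).mpr hmT
          have h2 : T < m * (T / m + 1) := Nat.lt_mul_div_succ T (by omega)
          have h3 : T ≤ (T / m) * (2 * m) := by nlinarith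
          rw [div_le_iff₀ (by positivity)]
          exact_mod_cast h3
      _ ≤ ∑ m ∈ Icc 1 B, residueClass b m * (T / m : ℕ) :=
          Finset.sum_le_sum_of_subset_of_nonneg (Finset.Icc_subset_Icc_right hBT)
            fun m _ _ ↦ mul_nonneg (hres0 m) (Nat.cast_nonneg _)
      _ ≤ _ := hupper
  have htend : Filter.Tendsto (fun T : ℕ ↦ log (T : ℝ)) Filter.atTop Filter.atTop :=
    tendsto_log_atTop.comp tendsto_natCast_atTop_atTop
  obtain ⟨T₀, hT₀⟩ := Filter.eventually_atTop.mp ((Filter.eventually_ge_atTop 1).and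
    ((htend.eventually_ge_atTop (log (2 * G))).and ((htend.eventually_ge_atTop (2 * C / c)).and
      (htend.eventually_ge_atTop 1))))
  refine ⟨c / 12, by positivity, T₀, fun T hT ↦ ?_⟩
  obtain ⟨h1, h2, h3, h4⟩ := hT₀ T hT
  have hmain := main T h1
  set r := #((Icc 1 T).biUnion fun t : ℕ ↦ (g * (t : ℤ) ^ 2 - 1).natAbs.primeFactors)
  have hT0 : (0 : ℝ) < T := by exact_mod_cast h1
  have hGpos : (0 : ℝ) < G := by exact_mod_cast (by omega : 0 < G)
  have hlog : log ((2 * G * T ^ 2 : ℕ) : ℝ) ≤ 3 * log T := by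
    push_cast
    rw [log_mul (by positivity) (by positivity), log_pow]
    push_cast
    linarith
  rw [div_le_iff₀ hc] at h3
  have h5 : (T : ℝ) / 2 * (c / 2 * log T) ≤ r * (3 * log T) :=
    (mul_le_mul_of_nonneg_left (by linarith) (by positivity)).trans
      (hmain.trans (mul_le_mul_of_nonneg_left hlog (by positivity)))
  have h6 : (c / 12 * T) * log T ≤ r * log T := by linarith
  exact le_of_mul_le_mul_right h6 (by linarith)

theorem exists_forall_ge_eval_ne_zero {f : Polynomial ℤ} (hf : f ≠ 0) :
    ∃ M : ℕ, ∀ x : ℤ, M ≤ x → f.eval x ≠ 0 := by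
  obtain ⟨M, hM⟩ := f.roots.toFinset.exists_le
  refine ⟨(M + 1).toNat, fun x hx h0 ↦ ?_⟩
  have := hM x (by simpa [hf] using h0)
  omega

theorem dvd_eval_of_dvd_sub {f : Polynomial ℤ} {p x y : ℤ} (h : p ∣ x - y) (hy : p ∣ f.eval y) :
    p ∣ f.eval x := by
  have := (h.trans (Polynomial.sub_dvd_eval_sub x y f)).add hy
  simpa using this

theorem exists_block_of_cover_residues {f : Polynomial ℤ} (hf : f ≠ 0) {u v : ℤ} (huv : u < v)
    (s : Finset ℕ) (hs : ∀ p ∈ s, p.Prime) (c : ℕ → ℤ)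
    (h : ∀ x ∈ Icc u v, ∃ y ∈ Icc u v, y ≠ x ∧
      ∃ p ∈ s, (p : ℤ) ∣ f.eval (c p + x) ∧ (p : ℤ) ∣ f.eval (c p + y)) :
    ∃ k : ℕ, 2 ≤ k ∧ ∃ n : ℕ, ∀ i ∈ Finset.Icc 1 k, ∃ j ∈ Finset.Icc 1 k, j ≠ i ∧
      1 < Int.gcd (f.eval ((n + i : ℕ) : ℤ)) (f.eval ((n + j : ℕ) : ℤ)) := by
  obtain ⟨M, hM⟩ := exists_forall_ge_eval_ne_zero hf
  obtain ⟨n₀, hn₀⟩ := Nat.chineseRemainderOfFinset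
    (fun p : ℕ ↦ ((c p + u - 1) % p).toNat) id s (fun p hp ↦ (hs p hp).ne_zero)
    fun p hp q hq hpq ↦ (Nat.coprime_primes (hs p hp) (hs q hq)).mpr hpq
  set Q := ∏ p ∈ s, p
  have hQ : 1 ≤ Q := Finset.prod_pos fun p hp ↦ (hs p hp).pos
  set n := n₀ + M * Q with hn
  have hnc (p : ℕ) (hp : p ∈ s) : (p : ℤ) ∣ n - (c p + u - 1) := by
    have hp0 : (p : ℤ) ≠ 0 := by exact_mod_cast (hs p hp).ne_zero
    have h1 : (p : ℤ) ∣ n₀ - (c p + u - 1) := by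
      have h2 := (Int.natCast_modEq_iff.mpr (hn₀ p hp))
      rw [Int.toNat_of_nonneg (Int.emod_nonneg _ hp0)] at h2
      exact (h2.trans (Int.mod_modEq _ _)).symm.dvd
    have h2 : (p : ℤ) ∣ (M * Q : ℕ) :=
      Int.natCast_dvd_natCast.mpr ((Finset.dvd_prod_of_mem _ hp).mul_left _)
    rw [show (n : ℤ) - (c p + u - 1) = n₀ - (c p + u - 1) + (M * Q : ℕ) by rw [hn]; push_cast; ring]
    exact h1.add h2
  have hnM : M ≤ n := by nlinarith
  refine ⟨(v - u + 1).toNat, by omega, n, fun i hi ↦ ?_⟩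
  rw [Finset.mem_Icc] at hi
  obtain ⟨y, hy, hne, p, hp, h1, h2⟩ := h (u - 1 + i) (by rw [Finset.mem_Icc]; omega)
  rw [Finset.mem_Icc] at hy
  refine ⟨(y - u + 1).toNat, by rw [Finset.mem_Icc]; omega, by omega, ?_⟩
  have h3 : (p : ℤ) ∣ f.eval ((n + i : ℕ) : ℤ) := by
    refine dvd_eval_of_dvd_sub ?_ h1
    convert hnc p hp using 1
    push_cast
    ring
  have h4 : (p : ℤ) ∣ f.eval ((n + (y - u + 1).toNat : ℕ) : ℤ) := by
    refine dvd_eval_of_dvd_sub ?_ h2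
    convert hnc p hp using 1
    push_cast
    rw [Int.toNat_of_nonneg (by omega)]
    ring
  have h5 : p ∣ Int.gcd (f.eval ((n + i : ℕ) : ℤ)) (f.eval ((n + (y - u + 1).toNat : ℕ) : ℤ)) :=
    Int.dvd_gcd h3 h4
  refine (hs p hp).one_lt.trans_le (Nat.le_of_dvd (Int.gcd_pos_of_ne_zero_left _ ?_) h5)
  exact hM _ (by push_cast; omega)

theorem exists_block_of_cover {f : Polynomial ℤ} (hf : f ≠ 0) {u v : ℤ} (huv : u < v)
    (P : Finset ℕ) (hP : ∀ p ∈ P, p.Prime ∧ ∃ r : ℤ, (p : ℤ) ∣ f.eval r)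
    (W : Finset ℤ) (φ : ℤ → ℕ) (hφ : Set.InjOn φ W)
    (hW : ∀ x ∈ W, (φ x).Prime ∧ φ x ∉ P ∧ ∃ y ∈ Icc u v, y ≠ x ∧
      ∃ r : ℤ, (φ x : ℤ) ∣ f.eval (r + x) ∧ (φ x : ℤ) ∣ f.eval (r + y))
    (hcov : ∀ x ∈ Icc u v, x ∉ W → ∃ y ∈ Icc u v, y ≠ x ∧ ∃ p ∈ P, (p : ℤ) ∣ x ∧ (p : ℤ) ∣ y) :
    ∃ k : ℕ, 2 ≤ k ∧ ∃ n : ℕ, ∀ i ∈ Finset.Icc 1 k, ∃ j ∈ Finset.Icc 1 k, j ≠ i ∧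
      1 < Int.gcd (f.eval ((n + i : ℕ) : ℤ)) (f.eval ((n + j : ℕ) : ℤ)) := by
  choose! hWp hWP z h_z h_zne ρ hρ hρ' using hW
  have hc (p : ℕ) : ∃ c : ℤ, (p ∈ P → (p : ℤ) ∣ f.eval c) ∧ ∀ x ∈ W, φ x = p → c = ρ x := by
    by_cases hp : p ∈ P
    · obtain ⟨r, hr⟩ := (hP p hp).2
      exact ⟨r, fun _ ↦ hr, fun x hx hxp ↦ absurd (hxp ▸ hp) (hWP x hx)⟩
    · by_cases hx : ∃ x ∈ W, φ x = p
      · obtain ⟨x, hx, rfl⟩ := hx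
        exact ⟨ρ x, fun h ↦ absurd h hp, fun y hy hyx ↦ by rw [hφ hy hx hyx]⟩
      · exact ⟨0, fun h ↦ absurd h hp, fun x h1 h2 ↦ absurd ⟨x, h1, h2⟩ hx⟩
  choose c hcP hcW using hc
  refine exists_block_of_cover_residues hf huv (P ∪ W.image φ) (fun p hp ↦ ?_) c fun x hx ↦ ?_
  · rcases Finset.mem_union.mp hp with hp | hp
    · exact (hP p hp).1
    · obtain ⟨x, hx, rfl⟩ := Finset.mem_image.mp hp
      exact hWp x hx
  · by_cases hxW : x ∈ W
    · refine ⟨z x, h_z x hxW, h_zne x hxW, φ x,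
        Finset.mem_union_right _ (Finset.mem_image_of_mem _ hxW), ?_⟩
      rw [hcW _ x hxW rfl]
      exact ⟨hρ x hxW, hρ' x hxW⟩
    · obtain ⟨y, hy, hne, p, hp, hpx, hpy⟩ := hcov x hx hxW
      exact ⟨y, hy, hne, p, Finset.mem_union_left _ hp,
        dvd_eval_of_dvd_sub (by simpa using hpx) (hcP p hp),
        dvd_eval_of_dvd_sub (by simpa using hpy) (hcP p hp)⟩
theorem exists_injOn_maps_of_card_le {α β : Type*} [Nonempty β] {s : Finset α} {t : Finset β}
    (h : #s ≤ #t) : ∃ φ : α → β, (∀ x ∈ s, φ x ∈ t) ∧ Set.InjOn φ s := by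
  obtain ⟨φ, h1, h2⟩ := s.finite_toSet.exists_injOn_of_encard_le (t := (t : Set β))
    (by simpa using h)
  exact ⟨φ, fun x hx ↦ h1 hx, h2⟩

theorem exists_dvd_mul_add {p : ℕ} (hp : p.Prime) {A : ℤ} (hA : ¬ (p : ℤ) ∣ A) (B : ℤ) :
    ∃ r : ℤ, (p : ℤ) ∣ A * r + B := by
  obtain ⟨u, v, h⟩ := ((Nat.prime_iff_prime_int.mp hp).coprime_iff_not_dvd.mpr hA)
  exact ⟨-B * v, B * u, by linear_combination -B * h⟩

theorem dvd_quadratic_of_dvd_sq_sub_discrim {p : ℕ} (hp : p.Prime) {a b c x : ℤ}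
    (hA : ¬ (p : ℤ) ∣ 2 * a) (h : (p : ℤ) ∣ (2 * a * x + b) ^ 2 - (b ^ 2 - 4 * a * c)) :
    (p : ℤ) ∣ a * x ^ 2 + b * x + c := by
  have hp' := Nat.prime_iff_prime_int.mp hp
  have h2 : ¬ (p : ℤ) ∣ 2 := fun h ↦ hA (h.mul_right _)
  rw [show (2 * a * x + b) ^ 2 - (b ^ 2 - 4 * a * c) = 2 * (2 * a * (a * x ^ 2 + b * x + c)) by
    ring] at h
  exact ((hp'.dvd_or_dvd ((hp'.dvd_or_dvd h).resolve_left h2)).resolve_left hA)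

theorem exists_dvd_quadratic_pair {p : ℕ} (hp : p.Prime) {a b c d : ℤ} (hA : ¬ (p : ℤ) ∣ 2 * a)
    (hd : (p : ℤ) ∣ a ^ 2 * d ^ 2 - (b ^ 2 - 4 * a * c)) :
    ∃ r : ℤ, (p : ℤ) ∣ a * r ^ 2 + b * r + c ∧ (p : ℤ) ∣ a * (r + d) ^ 2 + b * (r + d) + c := by
  obtain ⟨r, hr⟩ := exists_dvd_mul_add hp hA (b + a * d)
  refine ⟨r, dvd_quadratic_of_dvd_sq_sub_discrim hp hA ?_,
    dvd_quadratic_of_dvd_sq_sub_discrim hp hA ?_⟩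
  · obtain ⟨u, hu⟩ := hr
    obtain ⟨v, hv⟩ := hd
    exact ⟨u * (2 * a * r + b - a * d) + v,
      by linear_combination (2 * a * r + b - a * d) * hu + hv⟩
  · obtain ⟨u, hu⟩ := hr
    obtain ⟨v, hv⟩ := hd
    exact ⟨u * (2 * a * r + b + 3 * (a * d)) + v,
      by linear_combination (2 * a * r + b + 3 * (a * d)) * hu + hv⟩

theorem exists_dvd_quadratic_of_jacobiSym_eq_one {p : ℕ} (hp : p.Prime) {a b c : ℤ}
    (hA : ¬ (p : ℤ) ∣ 2 * a) (hJ : jacobiSym (b ^ 2 - 4 * a * c) p = 1) :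
    ∃ r : ℤ, (p : ℤ) ∣ a * r ^ 2 + b * r + c := by
  have := Fact.mk hp
  obtain ⟨e, he⟩ := ZMod.isSquare_of_jacobiSym_eq_one hJ
  obtain ⟨e, rfl⟩ := ZMod.intCast_surjective e
  have he' : (p : ℤ) ∣ e ^ 2 - (b ^ 2 - 4 * a * c) := by
    rw [← ZMod.intCast_zmod_eq_zero_iff_dvd, Int.cast_sub, he, Int.cast_pow, sq, sub_self]
  obtain ⟨r, hr⟩ := exists_dvd_mul_add hp hA (b - e)
  refine ⟨r, dvd_quadratic_of_dvd_sq_sub_discrim hp hA ?_⟩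
  obtain ⟨u, hu⟩ := hr
  obtain ⟨v, hv⟩ := he'
  exact ⟨u * (2 * a * r + b + e) + v, by linear_combination (2 * a * r + b + e) * hu + hv⟩

theorem jacobiSym_eq_one_of_prime_dvd {p : ℕ} (hp : p.Prime) {D s t : ℤ}
    (h : (p : ℤ) ∣ D * s ^ 2 * t ^ 2 - 1) : jacobiSym D p = 1 := by
  have hp' := Nat.prime_iff_prime_int.mp hp
  have hcop (w : ℤ) (hw : w ∣ D * s ^ 2 * t ^ 2) : Int.gcd w p = 1 := by
    rw [Int.gcd_comm, ← Int.isCoprime_iff_gcd_eq_one, hp'.coprime_iff_not_dvd]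
    intro hpw
    have := dvd_sub (hpw.trans hw) h
    rw [sub_sub_cancel] at this
    exact hp'.not_isUnit (isUnit_of_dvd_one this)
  have h1 : jacobiSym ((D * s * t) ^ 2) p = 1 := by
    rw [jacobiSym.pow_left, jacobiSym.mul_left, jacobiSym.mul_left]
    have e1 := jacobiSym.sq_one (hcop D ⟨s ^ 2 * t ^ 2, by ring⟩)
    have e2 := jacobiSym.sq_one (hcop s ⟨D * s * t ^ 2, by ring⟩)
    have e3 := jacobiSym.sq_one (hcop t ⟨D * s ^ 2 * t, by ring⟩)
    rw [mul_pow, mul_pow, e1, e2, e3]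
    norm_num
  rw [← h1]
  refine jacobiSym.mod_left' (Int.ModEq.symm (Int.modEq_iff_dvd.mpr ?_)).symm
  obtain ⟨u, hu⟩ := h
  exact ⟨D * u, by linear_combination D * hu⟩

theorem jacobiSym_congr_of_natCast_eq {D : ℤ} {m n : ℕ} (hm : Odd m) (hn : Odd n)
    (h : (m : ZMod (4 * D.natAbs)) = n) : jacobiSym D m = jacobiSym D n := by
  rw [jacobiSym.mod_right D hm, jacobiSym.mod_right D hn,
    (ZMod.natCast_eq_natCast_iff' _ _ _).mp h]

theorem exists_primes_prod_le_and_exists_dvd_quadratic {a b c : ℤ}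
    (ha : a ≠ 0) (hΔ : b ^ 2 - 4 * a * c ≠ 0) {ε : ℝ} (hε : 0 < ε) :
    ∃ P : Finset ℕ, (∀ p ∈ P, p.Prime ∧ ∃ r : ℤ, (p : ℤ) ∣ a * r ^ 2 + b * r + c) ∧
      ∏ p ∈ P, (1 - 1 / (p : ℝ)) ≤ ε := by
  set D := b ^ 2 - 4 * a * c with hD
  have hN : 4 * (a * D).natAbs ≠ 0 := by
    simpa using ⟨ha, hΔ⟩
  have : NeZero (4 * (a * D).natAbs) := ⟨hN⟩
  obtain ⟨P, hP, hPε⟩ :=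
    exists_primes_eq_mod_prod_le (isUnit_one (M := ZMod (4 * (a * D).natAbs))) hε
  refine ⟨P, fun p hp ↦ ⟨(hP p hp).1, ?_⟩, hPε⟩
  obtain ⟨hpp, hp1⟩ := hP p hp
  have hmod : (4 * (a * D).natAbs : ℤ) ∣ p - 1 := by
    have := (ZMod.intCast_zmod_eq_zero_iff_dvd (p - 1 : ℤ) (4 * (a * D).natAbs)).mp
      (by push_cast; rw [hp1, sub_self])
    exact_mod_cast this
  have hcop (w : ℤ) (hw : w ∣ 4 * (a * D).natAbs) : ¬ (p : ℤ) ∣ w := fun h ↦ by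
    have := dvd_sub (dvd_refl (p : ℤ)) (h.trans (hw.trans hmod))
    rw [sub_sub_cancel] at this
    exact (Nat.prime_iff_prime_int.mp hpp).not_isUnit (isUnit_of_dvd_one this)
  have haD : a * D ∣ ((a * D).natAbs : ℤ) := Int.dvd_natAbs.mpr dvd_rfl
  have hodd : Odd p := hpp.odd_of_ne_two fun h ↦
    hcop 2 (Dvd.dvd.mul_right (by norm_num) _) (by rw [h]; norm_num)
  refine exists_dvd_quadratic_of_jacobiSym_eq_one hpp
    (hcop _ (mul_dvd_mul (by norm_num) ((dvd_mul_right a D).trans haD))) ?_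
  rw [← hD, jacobiSym_congr_of_natCast_eq hodd odd_one, jacobiSym.one_right]
  rw [← sub_eq_zero]
  have := (ZMod.intCast_zmod_eq_zero_iff_dvd (p - 1 : ℤ) (4 * D.natAbs)).mpr ?_
  · exact_mod_cast this
  · refine dvd_trans ?_ hmod
    push_cast
    rw [abs_mul]
    exact mul_dvd_mul_left 4 (dvd_mul_left _ _)

theorem exists_mul_le_card_primeFactors_of_not_isSquare {D a : ℤ} (ha : a ≠ 0)
    (hD : ¬ IsSquare D) :
    ∃ c > (0 : ℝ), ∃ T₀ : ℕ, ∀ T ≥ T₀, c * T ≤ #((Icc 1 T).biUnion fun t : ℕ ↦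
      (D * (2 * a ^ 2) ^ 2 * (t : ℤ) ^ 2 - 1).natAbs.primeFactors) := by
  have hD0 : D ≠ 0 := by rintro rfl; exact hD ⟨0, rfl⟩
  obtain ⟨β, hβ, hJ⟩ := exists_coprime_jacobiSym_eq_neg_one hD
  have : NeZero (4 * D.natAbs) := ⟨by simpa using hD0⟩
  have hg : (2 : ℤ) ∣ D * (2 * a ^ 2) ^ 2 := ⟨D * (2 * a ^ 4), by ring⟩
  refine exists_mul_le_card_primeFactors hg (by positivity)
    ((ZMod.isUnit_iff_coprime β (4 * D.natAbs)).mpr hβ) fun p k hp hk hpk t hdvd ↦ ?_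
  have h1 := jacobiSym_eq_one_of_prime_dvd hp hdvd
  have hodd : Odd p := hp.odd_of_ne_two fun h ↦ by
    rw [h] at hdvd
    have := dvd_sub (hg.mul_right (t ^ 2)) hdvd
    rw [sub_sub_cancel] at this
    norm_num at this
  have hβodd : Odd β := Nat.Coprime.odd_of_right
    ((hβ.coprime_mul_right_right).coprime_dvd_right (by norm_num))
  rw [← jacobiSym_congr_of_natCast_eq hodd.pow hβodd hpk, jacobiSym.pow_right, h1, one_pow] at hJ
  norm_num at hJ

theorem card_filter_coprime_prod_le {P : Finset ℕ} (hP : ∀ p ∈ P, p.Prime) {ε : ℝ} (hε : 0 ≤ ε)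
    (h : ∏ p ∈ P, (1 - 1 / (p : ℝ)) ≤ ε) (k : ℕ) :
    (#((Ico 1 (1 + k)).filter fun x ↦ (∏ p ∈ P, p).Coprime x) : ℝ) ≤ ε * (k + ∏ p ∈ P, p : ℕ) := by
  set Q := ∏ p ∈ P, p with hQ
  have hQ0 : 0 < Q := Finset.prod_pos fun p hp ↦ (hP p hp).pos
  have hφ : (Q.totient : ℝ) ≤ Q * ε := by
    have h1 := congrArg (Rat.cast : ℚ → ℝ) (Nat.totient_eq_mul_prod_factors Q)
    rw [Nat.primeFactors_prod hP] at h1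
    push_cast at h1
    simp only [one_div] at h
    rw [h1]
    exact mul_le_mul_of_nonneg_left h (Nat.cast_nonneg _)
  have h2 : (#((Ico 1 (1 + k)).filter fun x ↦ Q.Coprime x) : ℝ) ≤ Q.totient * ((k / Q : ℕ) + 1) := by
    exact_mod_cast Nat.Ico_filter_coprime_le 1 k hQ0.ne'
  have h3 : (Q : ℝ) * (k / Q : ℕ) ≤ k := by exact_mod_cast Nat.mul_div_le k Q
  calc _ ≤ _ := h2
    _ ≤ Q * ε * ((k / Q : ℕ) + 1) := mul_le_mul_of_nonneg_right hφ (by positivity)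
    _ = ε * (Q * (k / Q : ℕ) + Q) := by ring
    _ ≤ _ := by
      push_cast
      exact mul_le_mul_of_nonneg_left (by linarith) hε

theorem exists_block_of_not_isSquare_discrim {f : Polynomial ℤ} (hf0 : f ≠ 0) {a b c : ℤ}
    (ha : a ≠ 0) (hf : ∀ x, f.eval x = a * x ^ 2 + b * x + c)
    (hΔ : ¬ IsSquare (b ^ 2 - 4 * a * c)) :
    ∃ k : ℕ, 2 ≤ k ∧ ∃ n : ℕ, ∀ i ∈ Finset.Icc 1 k, ∃ j ∈ Finset.Icc 1 k, j ≠ i ∧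
      1 < Int.gcd (f.eval ((n + i : ℕ) : ℤ)) (f.eval ((n + j : ℕ) : ℤ)) := by
  obtain ⟨κ, hκ, T₀, hT₀⟩ := exists_mul_le_card_primeFactors_of_not_isSquare ha hΔ
  set D := b ^ 2 - 4 * a * c with hD
  have hD0 : D ≠ 0 := by rintro h; exact hΔ ⟨0, by rw [h]; rfl⟩
  set L := 2 * (a * D).natAbs with hL
  have hL0 : 0 < L := by
    have := Int.natAbs_pos.mpr (mul_ne_zero ha hD0)
    omega
  have hLsq : (L : ℤ) ^ 2 = 4 * (a * D) ^ 2 := by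
    rw [hL]; push_cast; rw [mul_pow, sq_abs]; ring
  obtain ⟨P, hP, hPε⟩ := exists_primes_prod_le_and_exists_dvd_quadratic (b := b) (c := c) ha hD0
    (ε := κ / (8 * L)) (by positivity)
  set Q := ∏ p ∈ P, p with hQ
  have hQle (p : ℕ) (hp : p ∈ P) : p ≤ Q :=
    Nat.le_of_dvd (Finset.prod_pos fun p hp ↦ (hP p hp).1.pos) (Finset.dvd_prod_of_mem _ hp)
  obtain ⟨T₁, hT₁⟩ := exists_nat_ge (2 * #P / κ)
  set T := T₀ + T₁ + Q + 1 with hT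
  set K := L * T with hK
  have hTK : T ≤ K := Nat.le_mul_of_pos_left _ hL0
  set R := (Icc 1 T).biUnion fun t : ℕ ↦
    (D * (2 * a ^ 2) ^ 2 * (t : ℤ) ^ 2 - 1).natAbs.primeFactors with hR
  set W := ((Ico 1 (1 + 2 * K)).filter fun x ↦ Q.Coprime x).map (Nat.castEmbedding (R := ℤ)) with hW
  have hWcard : #W ≤ #(R \ P) := by
    have h1 := card_filter_coprime_prod_le (fun p hp ↦ (hP p hp).1) (by positivity) hPε (2 * K)
    have h2 := hT₀ T (by omega)
    have h3 : (#R : ℝ) ≤ #(R \ P) + #P := by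
      exact_mod_cast (Finset.card_le_card_sdiff_add_card)
    have h4 : (T₁ : ℝ) ≤ T := by exact_mod_cast (by omega : T₁ ≤ T)
    have h5 : 2 * (#P : ℝ) ≤ T * κ := by
      rw [div_le_iff₀ hκ] at hT₁
      exact hT₁.trans (mul_le_mul_of_nonneg_right h4 hκ.le)
    have h6 : κ / (8 * L) * ((2 * K + Q : ℕ) : ℝ) ≤ κ / 2 * T := by
      have : ((2 * K + Q : ℕ) : ℝ) ≤ 4 * L * T := by
        have : 2 * K + Q ≤ 4 * L * T := by nlinarith
        exact_mod_cast this
      calc _ ≤ κ / (8 * L) * (4 * L * T) := mul_le_mul_of_nonneg_left this (by positivity)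
        _ = κ / 2 * T := by field_simp; ring
    rw [hW, Finset.card_map]
    have : (#((Ico 1 (1 + 2 * K)).filter fun x ↦ Q.Coprime x) : ℝ) ≤ #(R \ P) := by linarith
    exact_mod_cast this
  obtain ⟨φ, hφ, hinj⟩ := exists_injOn_maps_of_card_le hWcard
  have hfP : ∀ p ∈ P, p.Prime ∧ ∃ r : ℤ, (p : ℤ) ∣ f.eval r := by simpa only [hf] using hP
  refine exists_block_of_cover hf0 (u := 1) (v := 2 * K) (by omega) P hfP W φ hinj
    (fun x hx ↦ ?_) fun x hx hxW ↦ ?_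
  · obtain ⟨hxR, hxP⟩ := Finset.mem_sdiff.mp (hφ x hx)
    set p := φ x
    obtain ⟨t, ht, hpt⟩ := Finset.mem_biUnion.mp hxR
    rw [Finset.mem_Icc] at ht
    have hpp := Nat.prime_of_mem_primeFactors hpt
    have hdvd := Int.natCast_dvd.mpr (Nat.dvd_of_mem_primeFactors hpt)
    have hA : ¬ (p : ℤ) ∣ 2 * a := fun h ↦ by
      have h' : 2 * a ∣ D * (2 * a ^ 2) ^ 2 * (t : ℤ) ^ 2 := ⟨2 * D * a ^ 3 * t ^ 2, by ring⟩
      have := dvd_sub (h.trans h') hdvd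
      rw [sub_sub_cancel] at this
      exact (Nat.prime_iff_prime_int.mp hpp).not_isUnit (isUnit_of_dvd_one this)
    have hd : (p : ℤ) ∣ a ^ 2 * ((L * t : ℕ) : ℤ) ^ 2 - (b ^ 2 - 4 * a * c) := by
      obtain ⟨u, hu⟩ := hdvd
      refine ⟨D * u, ?_⟩
      push_cast
      rw [← hD]
      linear_combination a ^ 2 * t ^ 2 * hLsq + D * hu
    have hLt1 : 1 ≤ L * t := Nat.mul_pos hL0 ht.1
    have hLt2 : L * t ≤ K := Nat.mul_le_mul_left _ ht.2
    obtain ⟨r, hr1, hr2⟩ := exists_dvd_quadratic_pair hpp hA hd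
    rw [← hf] at hr1 hr2
    obtain ⟨y, hy, rfl⟩ := Finset.mem_map.mp hx
    simp only [mem_filter, Finset.mem_Ico] at hy
    simp only [Nat.castEmbedding_apply]
    refine ⟨hpp, hxP, ?_⟩
    by_cases hyK : y ≤ K
    · refine ⟨y + (L * t : ℕ), by rw [Finset.mem_Icc]; omega, by omega, r - y, ?_, ?_⟩
      · rwa [sub_add_cancel]
      · rwa [show r - y + ((y : ℤ) + (L * t : ℕ)) = r + (L * t : ℕ) by ring]
    · refine ⟨y - (L * t : ℕ), by rw [Finset.mem_Icc]; omega, by omega,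
        r - y + (L * t : ℕ), ?_, ?_⟩
      · rwa [show r - y + ((L * t : ℕ) : ℤ) + y = r + (L * t : ℕ) by ring]
      · rwa [show r - y + ((L * t : ℕ) : ℤ) + (y - (L * t : ℕ)) = r by ring]
  · rw [Finset.mem_Icc] at hx
    lift x to ℕ using by omega
    have hxQ : ¬ Q.Coprime x := fun h ↦ hxW (Finset.mem_map.mpr ⟨x, by
      simp only [mem_filter, Finset.mem_Ico]; exact ⟨by omega, h⟩, rfl⟩)
    obtain ⟨p, hp, hpQ, hpx⟩ := Nat.Prime.not_coprime_iff_dvd.mp hxQ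
    obtain ⟨p', hp', hpp'⟩ := (hp.prime.dvd_finsetProd_iff _).mp hpQ
    obtain rfl := (Nat.prime_dvd_prime_iff_eq hp (hP p' hp').1).mp hpp'
    have hpK := hQle p hp'
    have := hp.pos
    have hpx' := Int.natCast_dvd_natCast.mpr hpx
    by_cases hxK : x ≤ K
    · exact ⟨x + p, by rw [Finset.mem_Icc]; omega, by omega, p, hp', hpx', hpx'.add dvd_rfl⟩
    · exact ⟨x - p, by rw [Finset.mem_Icc]; omega, by omega, p, hp', hpx', dvd_sub hpx' dvd_rfl⟩

theorem exists_mul_sqrt_two_pow_le_card_primes (C : ℝ) (N : ℕ) :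
    ∃ j ≥ N, C * √2 ^ j ≤ #((Ico (2 ^ j) (2 ^ (j + 1))).filter Nat.Prime) := by
  by_contra! hcon
  set h : ℕ → ℝ := Set.indicator {p : ℕ | p.Prime} fun n ↦ 1 / (n : ℝ) with hh
  have hnn (n : ℕ) : 0 ≤ h n := Set.indicator_nonneg (fun _ _ ↦ by positivity) n
  have hρ : √2 / 2 < 1 := by
    rw [div_lt_one two_pos, sqrt_lt' two_pos]
    norm_num
  have hsum := summable_geometric_of_lt_one (by positivity) hρ
  have hC : 0 ≤ C := by
    by_contra! hC
    have h1 := hcon N le_rfl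
    have h2 : C * √2 ^ N ≤ 0 := mul_nonpos_of_nonpos_of_nonneg hC.le (by positivity)
    have h3 : (0 : ℝ) ≤ #((Ico (2 ^ N) (2 ^ (N + 1))).filter Nat.Prime) := Nat.cast_nonneg _
    linarith
  have hblock (j : ℕ) (hj : N ≤ j) :
      ∑ n ∈ Ico (2 ^ j) (2 ^ (j + 1)), h n ≤ C * (√2 / 2) ^ j := by
    calc ∑ n ∈ Ico (2 ^ j) (2 ^ (j + 1)), h n
        = ∑ n ∈ (Ico (2 ^ j) (2 ^ (j + 1))).filter Nat.Prime, 1 / (n : ℝ) := by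
          rw [Finset.sum_filter]
          exact Finset.sum_congr rfl fun n _ ↦ Set.indicator_apply _ _ _
      _ ≤ #((Ico (2 ^ j) (2 ^ (j + 1))).filter Nat.Prime) • (1 / 2 ^ j : ℝ) := by
          refine Finset.sum_le_card_nsmul _ _ _ fun n hn ↦ ?_
          have := (Finset.mem_Ico.mp (mem_filter.mp hn).1).1
          exact one_div_le_one_div_of_le (by positivity) (by exact_mod_cast this)
      _ ≤ C * √2 ^ j * (1 / 2 ^ j) := by
          rw [nsmul_eq_mul]
          exact mul_le_mul_of_nonneg_right (hcon j hj).le (by positivity)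
      _ = C * (√2 / 2) ^ j := by rw [div_pow]; ring
  have hpart (J : ℕ) (hJ : N ≤ J) : ∑ n ∈ range (2 ^ J), h n ≤
      ∑ n ∈ range (2 ^ N), h n + C * ∑ j ∈ range J, (√2 / 2) ^ j := by
    induction J, hJ using Nat.le_induction with
    | base =>
      have : 0 ≤ C * ∑ j ∈ range N, (√2 / 2) ^ j := by positivity
      linarith
    | succ J hJ ih =>
      rw [← Finset.sum_range_add_sum_Ico _ (Nat.pow_le_pow_right two_pos J.le_succ),
        Finset.sum_range_succ _ J, mul_add]
      linarith [hblock J hJ]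
  refine not_summable_one_div_on_primes (summable_of_sum_range_le hnn (c :=
    ∑ n ∈ range (2 ^ N), h n + C * ∑' j, (√2 / 2) ^ j) fun n ↦ ?_)
  calc ∑ i ∈ range n, h i ≤ ∑ i ∈ range (2 ^ (n + N)), h i :=
        Finset.sum_le_sum_of_subset_of_nonneg (Finset.range_subset_range.mpr
          (Nat.lt_two_pow_self.le.trans (Nat.pow_le_pow_right two_pos (Nat.le_add_right n N))))
          fun i _ _ ↦ hnn i
    _ ≤ _ := hpart _ (Nat.le_add_left N n)
    _ ≤ _ := by
      gcongr
      exact hsum.sum_le_tsum _ fun _ _ ↦ by positivity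

theorem exists_card_filter_lt_eq {G : Finset ℕ} {s : ℕ} (h : s < #G) :
    ∃ M ∈ G, #(G.filter (· < M)) = s := by
  have hfin : (Set.ofPred (· ∈ G)).Finite := G.finite_toSet
  have hlt : s < #hfin.toFinset := by
    rwa [show hfin.toFinset = G from Finset.ext fun _ ↦ hfin.mem_toFinset]
  refine ⟨Nat.nth (· ∈ G) s, Nat.nth_mem_of_lt_card hfin hlt, ?_⟩
  have := Nat.count_nth_of_lt_card_finite hfin hlt
  rw [Nat.count_eq_card_filter_range] at this
  convert this using 2
  ext x
  simp [and_comm]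

theorem card_filter_natAbs_mem_le (s : Finset ℤ) (S : Finset ℕ) :
    #(s.filter fun x ↦ x.natAbs ∈ S) ≤ 2 * #S := by
  calc _ ≤ #(S.image (fun n : ℕ ↦ (n : ℤ)) ∪ S.image fun n : ℕ ↦ -(n : ℤ)) := by
        refine Finset.card_le_card fun x hx ↦ ?_
        have hxS := (mem_filter.mp hx).2
        rcases Int.natAbs_eq x with h | h
        · exact Finset.mem_union_left _ (Finset.mem_image.mpr ⟨_, hxS, h.symm⟩)
        · exact Finset.mem_union_right _ (Finset.mem_image.mpr ⟨_, hxS, h.symm⟩)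
    _ ≤ #S + #S := (Finset.card_union_le _ _).trans
        (add_le_add Finset.card_image_le Finset.card_image_le)
    _ = 2 * #S := (two_mul _).symm

theorem exists_int_sub_or_add_mem_Icc {m : ℤ} {p : ℕ} {x : ℤ} (hp : p ≠ 0) (hx : x ∈ Icc (-m) m)
    (hpm : p ≤ m + |x|) : ∃ y ∈ Icc (-m) m, y ≠ x ∧ (p : ℤ) ∣ y - x := by
  rw [Finset.mem_Icc] at hx
  rcases le_total 0 x with h | h
  · rw [abs_of_nonneg h] at hpm
    exact ⟨x - p, by rw [Finset.mem_Icc]; omega, by omega, -1, by ring⟩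
  · rw [abs_of_nonpos h] at hpm
    exact ⟨x + p, by rw [Finset.mem_Icc]; omega, by omega, 1, by ring⟩

theorem exists_block_of_forall_prime_exists_dvd {f : Polynomial ℤ} (hf0 : f ≠ 0) {U : ℕ}
    (hU : U ≠ 0) (hf : ∀ p : ℕ, p.Prime → ¬ p ∣ U → ∃ r : ℤ, (p : ℤ) ∣ f.eval r) :
    ∃ k : ℕ, 2 ≤ k ∧ ∃ n : ℕ, ∀ i ∈ Finset.Icc 1 k, ∃ j ∈ Finset.Icc 1 k, j ≠ i ∧
      1 < Int.gcd (f.eval ((n + i : ℕ) : ℤ)) (f.eval ((n + j : ℕ) : ℤ)) := by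
  classical
  set κ := 2 ^ #(U + 1).primesBelow with hκ
  have hκ1 : 1 ≤ κ := Nat.one_le_two_pow
  obtain ⟨j, hj, hjC⟩ := exists_mul_sqrt_two_pow_le_card_primes (32 * κ) (U + 1)
  set A := 2 ^ j with hA
  have hA2 : 2 ^ (j + 1) = 2 * A := by rw [pow_succ, mul_comm]
  rw [hA2] at hjC
  set G := (Ico A (2 * A)).filter Nat.Prime with hG
  have hUA : U < A := (by omega : U < j).trans Nat.lt_two_pow_self
  set s := 2 * (κ * Nat.sqrt (2 * A) + 1) with hs
  have hsG : 3 * s < #G := by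
    have hsq : (Nat.sqrt (2 * A) : ℝ) ≤ 2 * √2 ^ j := by
      refine nat_sqrt_le_real_sqrt.trans (sqrt_le_left (by positivity) |>.mpr ?_ )
      rw [mul_pow, ← pow_mul, mul_comm j, pow_mul, sq_sqrt two_pos.le]
      have hAr : (A : ℝ) = 2 ^ j := by rw [hA]; norm_cast
      rw [Nat.cast_mul, hAr, Nat.cast_ofNat]
      linarith [pow_pos (two_pos : (0 : ℝ) < 2) j]
    have h1 : (1 : ℝ) ≤ √2 ^ j := one_le_pow₀ (one_le_sqrt.mpr one_le_two)
    have hκ1' : (1 : ℝ) ≤ κ := by exact_mod_cast hκ1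
    have h2 : (κ : ℝ) * Nat.sqrt (2 * A) ≤ κ * (2 * √2 ^ j) :=
      mul_le_mul_of_nonneg_left hsq (by positivity)
    have h3 : 1 ≤ κ * √2 ^ j := one_le_mul_of_one_le_of_one_le hκ1' h1
    have : ((3 * s : ℕ) : ℝ) < #G := by
      rw [hs]
      push_cast
      linarith
    exact_mod_cast this
  obtain ⟨M, hMG, hM⟩ := exists_card_filter_lt_eq (G := G) (s := s) (by omega)
  set F := G.filter (· < M) with hF
  have hGp (p : ℕ) (hp : p ∈ G) : p.Prime ∧ A ≤ p ∧ p < 2 * A ∧ ¬ p ∣ U := by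
    rw [hG, mem_filter, Finset.mem_Ico] at hp
    exact ⟨hp.2, hp.1.1, hp.1.2, fun h ↦ by have := Nat.le_of_dvd (by omega) h; omega⟩
  have hFp (p : ℕ) (hp : p ∈ F) : p ∈ G ∧ p < M := mem_filter.mp hp
  have hGF (p : ℕ) (hp : p ∈ G \ F) : p ∈ G ∧ M ≤ p := by
    obtain ⟨h1, h2⟩ := Finset.mem_sdiff.mp hp
    exact ⟨h1, not_lt.mp fun h ↦ h2 (mem_filter.mpr ⟨h1, h⟩)⟩
  have hM2 := hGp M hMG
  have hAM : A < M := by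
    obtain ⟨p, hp⟩ := Finset.card_pos.mp (by omega : 0 < #F)
    exact (hGp p (hFp p hp).1).2.1.trans_lt (hFp p hp).2
  obtain ⟨m, rfl⟩ : ∃ m, M = m + 1 := ⟨M - 1, by omega⟩
  set S := (range (m + 1)).filter fun x ↦ x = 0 ∨ ∀ p : ℕ, p.Prime → p ∣ x → p ∣ U with hS
  have hScard : #S ≤ κ * Nat.sqrt (2 * A) + 1 := by
    calc #S ≤ #(insert 0 (Nat.smoothNumbersUpTo m (U + 1))) := by
          refine Finset.card_le_card fun x hx ↦ ?_
          obtain ⟨hxm, hx⟩ := mem_filter.mp hx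
          rw [Finset.mem_insert]
          refine or_iff_not_imp_left.mpr fun hx0 ↦ ?_
          rw [Nat.mem_smoothNumbersUpTo, Nat.mem_smoothNumbers']
          refine ⟨by rw [Finset.mem_range] at hxm; omega, fun p hp hpx ↦ ?_⟩
          exact Nat.lt_succ_of_le (Nat.le_of_dvd (by omega) ((hx.resolve_left hx0) p hp hpx))
      _ ≤ #(Nat.smoothNumbersUpTo m (U + 1)) + 1 := Finset.card_insert_le _ _
      _ ≤ κ * Nat.sqrt m + 1 := by
          gcongr
          exact Nat.smoothNumbersUpTo_card_le m (U + 1)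
      _ ≤ _ := by
          gcongr
          omega
  set I := Icc (-(m : ℤ)) m with hI
  set W₁ := I.filter fun x ↦ x.natAbs ∈ S with hW₁
  set W₂ := I.filter fun x ↦ x.natAbs ∈ F with hW₂
  have hW₁card : #W₁ ≤ #F := (card_filter_natAbs_mem_le I S).trans (by omega)
  have hW₂card : #W₂ ≤ #(G \ F) := by
    have h1 : #W₂ ≤ 2 * #F := card_filter_natAbs_mem_le I F
    have h2 := Finset.card_le_card_sdiff_add_card (s := G) (t := F)
    omega
  obtain ⟨φ₁, hφ₁, hinj₁⟩ := exists_injOn_maps_of_card_le hW₁card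
  obtain ⟨φ₂, hφ₂, hinj₂⟩ := exists_injOn_maps_of_card_le hW₂card
  set P := (range (m + 1)).filter fun p ↦ p.Prime ∧ ¬ p ∣ U ∧ p ∉ F with hP
  set φ : ℤ → ℕ := fun x ↦ if x.natAbs ∈ F then φ₂ x else φ₁ x with hφ
  have hcase (x : ℤ) (hx : x ∈ W₁ ∪ W₂) : (x ∈ W₂ ∧ φ x = φ₂ x) ∨ (x ∈ W₁ ∧ φ x = φ₁ x) := by
    by_cases hxF : x.natAbs ∈ F
    · refine .inl ⟨mem_filter.mpr ⟨?_, hxF⟩, if_pos hxF⟩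
      rcases Finset.mem_union.mp hx with h | h <;> exact (mem_filter.mp h).1
    · exact .inr ⟨(Finset.mem_union.mp hx).resolve_right fun h ↦ hxF (mem_filter.mp h).2,
        if_neg hxF⟩
  refine exists_block_of_cover hf0 (u := -m) (v := m) (by omega) P (fun p hp ↦ ?_) (W₁ ∪ W₂) φ
    ?_ (fun x hx ↦ ?_) fun x hx hxW ↦ ?_
  · obtain ⟨-, h1, h2, -⟩ := mem_filter.mp hp
    exact ⟨h1, hf p h1 h2⟩
  · intro x hx y hy hxy
    rcases hcase x hx with ⟨hx, ex⟩ | ⟨hx, ex⟩ <;> rcases hcase y hy with ⟨hy, ey⟩ | ⟨hy, ey⟩ <;>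
      rw [ex, ey] at hxy
    · exact hinj₂ hx hy hxy
    · exact absurd (hφ₁ y hy) (hxy ▸ (Finset.mem_sdiff.mp (hφ₂ x hx)).2)
    · exact absurd (hφ₁ x hx) (hxy ▸ (Finset.mem_sdiff.mp (hφ₂ y hy)).2)
    · exact hinj₁ hx hy hxy
  · have hkey : φ x ∈ G ∧ φ x ∉ P ∧ x ∈ I ∧ (φ x : ℤ) ≤ m + |x| := by
      rcases hcase x hx with ⟨hx, ex⟩ | ⟨hx, ex⟩ <;> rw [ex]
      · obtain ⟨h1, h2⟩ := hGF _ (hφ₂ x hx)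
        obtain ⟨hxI, hxF⟩ := mem_filter.mp hx
        have h3 := (hGp _ (hFp _ hxF).1).2.1
        have h4 := (hGp _ h1).2.2.1
        refine ⟨h1, fun h ↦ ?_, hxI, ?_⟩
        · have := Finset.mem_range.mp (mem_filter.mp h).1
          omega
        · rw [Int.abs_eq_natAbs]
          omega
      · obtain ⟨h1, h2⟩ := hFp _ (hφ₁ x hx)
        refine ⟨h1, fun h ↦ (mem_filter.mp h).2.2.2 (hφ₁ x hx), (mem_filter.mp hx).1, ?_⟩
        have := abs_nonneg x
        omega
    obtain ⟨h1, h2, h3, h4⟩ := hkey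
    obtain ⟨hp, -, -, hpU⟩ := hGp _ h1
    obtain ⟨y, hy, hne, hdvd⟩ := exists_int_sub_or_add_mem_Icc hp.ne_zero h3 h4
    obtain ⟨r, hr⟩ := hf _ hp hpU
    exact ⟨hp, h2, y, hy, hne, r - x, by rwa [sub_add_cancel], dvd_eval_of_dvd_sub
      (by rwa [show r - x + y - r = y - x by ring]) hr⟩
  · have hxm : x.natAbs ≤ m := by
      rw [Finset.mem_Icc] at hx
      omega
    have hxS : x.natAbs ∉ S := fun h ↦
      hxW (Finset.mem_union_left _ (mem_filter.mpr ⟨hx, h⟩))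
    have hxF : x.natAbs ∉ F := fun h ↦
      hxW (Finset.mem_union_right _ (mem_filter.mpr ⟨hx, h⟩))
    rw [hS, mem_filter, Finset.mem_range] at hxS
    push Not at hxS
    obtain ⟨hx0, p, hp, hpx, hpU⟩ := hxS (by omega)
    have hple := Nat.le_of_dvd (by omega) hpx
    have hpF : p ∉ F := fun h ↦ by
      obtain ⟨l, hl⟩ := hpx
      have := hGp p (hFp p h).1
      have hl0 : l ≠ 0 := by
        rintro rfl
        exact hx0 (hl.trans (mul_zero p))
      have hl2 : l < 2 := by
        by_contra! h2
        have := Nat.mul_le_mul_left p h2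
        omega
      have hl1 : l = 1 := by omega
      rw [hl, hl1, mul_one] at hxF
      exact hxF h
    obtain ⟨y, hy, hne, hdvd⟩ := exists_int_sub_or_add_mem_Icc hp.ne_zero hx
      (by rw [Int.abs_eq_natAbs]; omega)
    have hpx' := Int.natCast_dvd.mpr hpx
    refine ⟨y, hy, hne, p,
      mem_filter.mpr ⟨Finset.mem_range.mpr (by omega), hp, hpU, hpF⟩, hpx', ?_⟩
    exact (dvd_iff_dvd_of_dvd_sub hdvd).mpr hpx'

theorem exists_block_of_isSquare_discrim {f : Polynomial ℤ} (hf0 : f ≠ 0) {a b c : ℤ}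
    (ha : a ≠ 0) (hf : ∀ x, f.eval x = a * x ^ 2 + b * x + c)
    (hΔ : IsSquare (b ^ 2 - 4 * a * c)) :
    ∃ k : ℕ, 2 ≤ k ∧ ∃ n : ℕ, ∀ i ∈ Finset.Icc 1 k, ∃ j ∈ Finset.Icc 1 k, j ≠ i ∧
      1 < Int.gcd (f.eval ((n + i : ℕ) : ℤ)) (f.eval ((n + j : ℕ) : ℤ)) := by
  obtain ⟨e, he⟩ := hΔ
  refine exists_block_of_forall_prime_exists_dvd hf0 (U := (2 * a).natAbs) (by simpa using ha)
    fun p hp hpU ↦ ?_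
  have hA : ¬ (p : ℤ) ∣ 2 * a := fun h ↦ hpU (Int.natCast_dvd.mp h)
  obtain ⟨r, w, hw⟩ := exists_dvd_mul_add hp hA (b - e)
  refine ⟨r, hf r ▸ dvd_quadratic_of_dvd_sq_sub_discrim hp hA ⟨w * (2 * a * r + b + e), ?_⟩⟩
  linear_combination (2 * a * r + b + e) * hw - he

end

/-- For a quadratic `f ∈ ℤ[X]`, there exist `k ≥ 2` and `n ≥ 0` such that none of
`f(n+1), …, f(n+k)` is coprime to all the others. -/
theorem stmt_1 (f : Polynomial ℤ) (hdeg : f.natDegree = 2) :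
    ∃ k : ℕ, 2 ≤ k ∧ ∃ n : ℕ, ∀ i ∈ Finset.Icc 1 k, ∃ j ∈ Finset.Icc 1 k, j ≠ i ∧
      1 < Int.gcd (f.eval ((n + i : ℕ) : ℤ)) (f.eval ((n + j : ℕ) : ℤ)) := by
  have hf0 : f ≠ 0 := by rintro rfl; simp at hdeg
  have ha : f.coeff 2 ≠ 0 := by
    rw [← hdeg]
    exact Polynomial.leadingCoeff_ne_zero.mpr hf0
  have hf (x : ℤ) : f.eval x = f.coeff 2 * x ^ 2 + f.coeff 1 * x + f.coeff 0 := by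
    rw [Polynomial.eval_eq_sum_range, hdeg, Finset.sum_range_succ, Finset.sum_range_succ,
      Finset.sum_range_one]
    ring
  by_cases hΔ : IsSquare (f.coeff 1 ^ 2 - 4 * f.coeff 2 * f.coeff 0)
  · exact exists_block_of_isSquare_discrim hf0 ha hf hΔ
  · exact exists_block_of_not_isSquare_discrim hf0 ha hf hΔ
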